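/- For any reals A and B: A ∈ KT(Δ⁰₂) and B ∈ KT(Δ⁰₂) if and only if A ⊕ B ∈ KT(Δ⁰₂), where A ⊕ B is the effective join. -/

import Mathlib

/-! Common framework: prefix-free Kolmogorov complexity via a universal
prefix-free oracle machine, Δ⁰₂ functions and orders, Turing and wtt
reducibility, Ω, and the uniform measure on Cantor space. -/

/-- Finite binary strings, `2^{<ω}`. -/
abbrev BinStr := List Bool

/-- Reals, i.e. infinite binary sequences `2^ω`. -/
abbrev Seq2 := ℕ → Bool

/-- The initial segment `A↾n` of a real `A ∈ 2^ω`. -/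
def restrict (A : Seq2) (n : ℕ) : BinStr := (List.range n).map A

/-- A prefix-free oracle machine, presented as a computable enumeration of
axioms `(τ, p, y)`, meaning: on any oracle extending `τ`, the machine halts on
program `p` with output `y`.  Consistency says that for compatible oracle
strings the halting programs form a prefix-free set and outputs are unique. -/
structure PrefixOracleMachine where
  axioms : ℕ → Option (BinStr × BinStr × BinStr)
  axioms_computable : Computable axioms
  consistent : ∀ s t τ₁ p₁ y₁ τ₂ p₂ y₂,
    axioms s = some (τ₁, p₁, y₁) → axioms t = some (τ₂, p₂, y₂) →
    (τ₁ <+: τ₂ ∨ τ₂ <+: τ₁) → p₁ <+: p₂ → p₁ = p₂ ∧ y₁ = y₂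

/-- `M.Computes A p y` : with oracle `A`, machine `M` halts on program `p` with
output `y`. -/
def PrefixOracleMachine.Computes (M : PrefixOracleMachine) (A : Seq2) (p y : BinStr) : Prop :=
  ∃ s τ, M.axioms s = some (τ, p, y) ∧ ∃ n, τ = restrict A n

/-- A universal prefix-free oracle machine: it describes every string (relative
to every oracle), and it simulates every prefix-free oracle machine up to an
additive constant in the length of programs. -/
structure UniversalPrefixMachine extends PrefixOracleMachine where
  total : ∀ (A : Seq2) (y : BinStr), ∃ p, toPrefixOracleMachine.Computes A p y
  universal : ∀ M : PrefixOracleMachine, ∃ c : ℕ, ∀ (A : Seq2) (p y : BinStr),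
    M.Computes A p y →
      ∃ q, toPrefixOracleMachine.Computes A q y ∧ q.length ≤ p.length + c

/-- `K^A(y)` : prefix-free Kolmogorov complexity of `y` relative to oracle `A`. -/
noncomputable def KOr (U : UniversalPrefixMachine) (A : Seq2) (y : BinStr) : ℕ :=
  sInf {n | ∃ p : BinStr, p.length = n ∧ U.toPrefixOracleMachine.Computes A p y}

/-- The all-zeros (recursive) oracle. -/
def zeroSeq : Seq2 := fun _ => false

/-- `K(y)` : (unrelativized) prefix-free Kolmogorov complexity. -/
noncomputable def Kc (U : UniversalPrefixMachine) (y : BinStr) : ℕ := KOr U zeroSeq y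

/-- `K(n)` : the complexity of the string of `n` zeros. -/
noncomputable def KcNat (U : UniversalPrefixMachine) (n : ℕ) : ℕ :=
  Kc U (List.replicate n false)

/-- `A ∈ KT(g)` : `A` is K-trivial up to `g`. -/
def KT (U : UniversalPrefixMachine) (g : ℕ → ℕ) (A : Seq2) : Prop :=
  ∃ c : ℕ, ∀ n : ℕ, Kc U (restrict A n) ≤ KcNat U n + g n + c

/-- `A ∈ LK(f)` : `A` is low for K up to `f`. -/
def LK (U : UniversalPrefixMachine) (f : BinStr → ℕ) (A : Seq2) : Prop :=
  ∃ c : ℕ, ∀ σ : BinStr, Kc U σ ≤ KOr U A σ + f σ + c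

/-- The position of a string in the length-lexicographic ordering of `2^{<ω}`. -/
def strNum (σ : BinStr) : ℕ := σ.foldl (fun n b => 2 * n + (if b then 2 else 1)) 0

/-- A function `ℕ → ℕ` is Δ⁰₂ iff it has a recursive approximation. -/
def Delta02Fun (g : ℕ → ℕ) : Prop :=
  ∃ G : ℕ → ℕ → ℕ, Computable₂ G ∧ ∀ x, ∃ t, ∀ s ≥ t, G s x = g x

/-- A function `2^{<ω} → ℕ` is Δ⁰₂ iff it has a recursive approximation. -/
def Delta02StrFun (f : BinStr → ℕ) : Prop :=
  ∃ F : ℕ → BinStr → ℕ, Computable₂ F ∧ ∀ σ, ∃ t, ∀ s ≥ t, F s σ = f σ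

/-- A real is Δ⁰₂ iff it has a recursive approximation. -/
def Delta02Seq (A : Seq2) : Prop :=
  ∃ F : ℕ → ℕ → Bool, Computable₂ F ∧ ∀ x, ∃ t, ∀ s ≥ t, F s x = A x

/-- An order: an unbounded nondecreasing function `ℕ → ℕ`. -/
def IsOrder (g : ℕ → ℕ) : Prop := Monotone g ∧ ∀ b : ℕ, ∃ m, b < g m

/-- An order on strings: unbounded and nondecreasing with respect to the
length-lexicographic ordering of `2^{<ω}`. -/
def IsStrOrder (f : BinStr → ℕ) : Prop :=
  (∀ σ τ : BinStr, strNum σ ≤ strNum τ → f σ ≤ f τ) ∧ ∀ b : ℕ, ∃ σ, b < f σ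

/-- `A ∈ KT(Δ⁰₂)` : `A` is K-trivial up to every Δ⁰₂ order. -/
def KTDelta (U : UniversalPrefixMachine) (A : Seq2) : Prop :=
  ∀ g : ℕ → ℕ, Delta02Fun g → IsOrder g → KT U g A

/-- `A ∈ LK(Δ⁰₂)` : `A` is low for K up to every Δ⁰₂ order. -/
def LKDelta (U : UniversalPrefixMachine) (A : Seq2) : Prop :=
  ∀ f : BinStr → ℕ, Delta02StrFun f → IsStrOrder f → LK U f A

/-- A Δ⁰₂ function is finite-to-one approximable if it has a recursive
approximation `F` such that for every `n`, for all but finitely many `m`,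
`F s m > n` for all stages `s`. -/
def FinToOneApprox (f : ℕ → ℕ) : Prop :=
  ∃ F : ℕ → ℕ → ℕ, Computable₂ F ∧ (∀ x, ∃ t, ∀ s ≥ t, F s x = f x) ∧
    ∀ n : ℕ, {m : ℕ | ∃ s, F s m ≤ n}.Finite

/-- A Turing functional, presented as a computable enumeration of axioms
`(τ, n, b)`, meaning: on any oracle extending `τ`, the output bit `n` is `b`. -/
structure TuringFunctional where
  axioms : ℕ → Option (BinStr × ℕ × Bool)
  axioms_computable : Computable axioms
  consistent : ∀ s t τ₁ n₁ b₁ τ₂ n₂ b₂,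
    axioms s = some (τ₁, n₁, b₁) → axioms t = some (τ₂, n₂, b₂) →
    (τ₁ <+: τ₂ ∨ τ₂ <+: τ₁) → n₁ = n₂ → b₁ = b₂

/-- `Φ.Computes B A` : `Φ^B = A`. -/
def TuringFunctional.Computes (Φ : TuringFunctional) (B A : Seq2) : Prop :=
  ∀ n : ℕ, ∃ s k, Φ.axioms s = some (restrict B k, n, A n)

/-- Turing reducibility `A ≤_T B`. -/
def TuringLE (A B : Seq2) : Prop := ∃ Φ : TuringFunctional, Φ.Computes B A

/-- Weak truth-table reducibility `A ≤_wtt B` : a Turing reduction whose use is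
bounded by a recursive function. -/
def WttLE (A B : Seq2) : Prop :=
  ∃ (Φ : TuringFunctional) (u : ℕ → ℕ), Computable u ∧
    ∀ n : ℕ, ∃ s k, k ≤ u n ∧ Φ.axioms s = some (restrict B k, n, A n)

/-- The effective join `A ⊕ B`. -/
def join (A B : Seq2) : Seq2 := fun n => if n % 2 = 0 then A (n / 2) else B (n / 2)

/-- `A` is Martin-Löf random: `K(A↾n) ≥ n - c` for all `n`. -/
def MLRandom (U : UniversalPrefixMachine) (A : Seq2) : Prop :=
  ∃ c : ℕ, ∀ n : ℕ, n ≤ Kc U (restrict A n) + c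

/-- `A` is infinitely often K-trivial. -/
def InfOftenKTrivial (U : UniversalPrefixMachine) (A : Seq2) : Prop :=
  ∃ c : ℕ, {n : ℕ | Kc U (restrict A n) ≤ KcNat U n + c}.Infinite

/-- K-reducibility `B ≤_K A`. -/
def KLE (U : UniversalPrefixMachine) (B A : Seq2) : Prop :=
  ∃ c : ℕ, ∀ n : ℕ, Kc U (restrict B n) ≤ Kc U (restrict A n) + c

/-- LK-reducibility `A ≤_LK B`. -/
def LKLE (U : UniversalPrefixMachine) (A B : Seq2) : Prop :=
  ∃ c : ℕ, ∀ σ : BinStr, KOr U B σ ≤ KOr U A σ + c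

/-- `A` is weakly low for K: `K(σ) ≤ K^A(σ) + c` for infinitely many strings σ. -/
def WeaklyLowForK (U : UniversalPrefixMachine) (A : Seq2) : Prop :=
  ∃ c : ℕ, {σ : BinStr | Kc U σ ≤ KOr U A σ + c}.Infinite

/-- Chaitin's Ω : the measure of the domain of the universal machine. -/
noncomputable def Omega (U : UniversalPrefixMachine) : ℝ :=
  ∑' p : {p : BinStr // ∃ y, U.toPrefixOracleMachine.Computes zeroSeq p y},
    ((2 : ℝ) ^ (p : BinStr).length)⁻¹

/-- The `n`-th binary digit of a real number `x`. -/
noncomputable def realBit (x : ℝ) (n : ℕ) : Bool :=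
  decide (⌊x * 2 ^ (n + 1)⌋ % 2 = 1)

/-- `Ω↾n` : the length-`n` initial segment of the binary expansion of Ω. -/
noncomputable def omegaStr (U : UniversalPrefixMachine) (n : ℕ) : BinStr :=
  (List.range n).map (realBit (Omega U))

/-- `A` is low for Ω. -/
def LowForOmega (U : UniversalPrefixMachine) (A : Seq2) : Prop :=
  ∀ c : ℕ, ∃ n : ℕ, KOr U A (omegaStr U n) + c < n

/-- The uniform (coin-flipping) measure on `2^ω`, obtained as the image of
Lebesgue measure on `[0,1]` under the binary-expansion map. -/
noncomputable def cantorMeasure : MeasureTheory.Measure Seq2 :=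
  MeasureTheory.Measure.map (fun x : ℝ => fun n : ℕ => realBit x n)
    (MeasureTheory.volume.restrict (Set.Icc (0 : ℝ) 1))

/-- An enumeration of pairs (program, output) whose programs form a prefix-free set and determine
their outputs. -/
def IsPrefixCode (E : ℕ → Option (BinStr × BinStr)) : Prop :=
  ∀ s t p y q z, E s = some (p, y) → E t = some (q, z) → p <+: q → p = q ∧ y = z

theorem Kc_le_of_computes {U : UniversalPrefixMachine} {p y : BinStr}
    (h : U.toPrefixOracleMachine.Computes zeroSeq p y) : Kc U y ≤ p.length :=
  Nat.sInf_le ⟨p, rfl, h⟩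

theorem exists_computes_length_eq_Kc (U : UniversalPrefixMachine) (y : BinStr) :
    ∃ p : BinStr, p.length = Kc U y ∧ U.toPrefixOracleMachine.Computes zeroSeq p y := by
  obtain ⟨p, hp⟩ := U.total zeroSeq y
  exact Nat.sInf_mem (s := {n | ∃ p : BinStr, p.length = n ∧ U.toPrefixOracleMachine.Computes
    zeroSeq p y}) ⟨p.length, p, rfl, hp⟩

/-- A computable prefix code is simulated by the universal machine. -/
theorem IsPrefixCode.exists_Kc_le (U : UniversalPrefixMachine) {E : ℕ → Option (BinStr × BinStr)}
    (hE : IsPrefixCode E) (hc : Computable E) :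
    ∃ c, ∀ s p y, E s = some (p, y) → Kc U y ≤ p.length + c := by
  let M : PrefixOracleMachine :=
    { axioms := fun s => (E s).map fun r => ([], r)
      axioms_computable :=
        Computable.option_map hc ((Computable.pair (Computable.const []) Computable.snd).to₂)
      consistent := by
        intro s t τ₁ p₁ y₁ τ₂ p₂ y₂ h₁ h₂ _ hp
        simp only [Option.map_eq_some_iff, Prod.mk.injEq] at h₁ h₂
        obtain ⟨⟨a, b⟩, h₁, -, h₁'⟩ := h₁
        obtain ⟨⟨a', b'⟩, h₂, -, h₂'⟩ := h₂
        simp only [Prod.mk.injEq] at h₁' h₂'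
        obtain ⟨rfl, rfl⟩ := h₁'
        obtain ⟨rfl, rfl⟩ := h₂'
        exact hE s t _ _ _ _ h₁ h₂ hp }
  obtain ⟨c, hcU⟩ := U.universal M
  refine ⟨c, fun s p y h => ?_⟩
  obtain ⟨q, hq, hql⟩ := hcU zeroSeq p y ⟨s, [], by simp [M, h], 0, by simp [restrict]⟩
  exact (Kc_le_of_computes hq).trans hql

theorem Computable.decide_eq {α β : Type*} [Primcodable α] [Primcodable β] [DecidableEq β]
    {f g : α → β} (hf : Computable f) (hg : Computable g) :
    Computable fun a => decide (f a = g a) :=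
  (Primrec.eq.decide.to_comp.comp hf hg :)

/-- The number of earlier occurrences of the value `key t` in the sequence `key`. -/
def occ {α : Type*} [DecidableEq α] (key : ℕ → α) (t : ℕ) : ℕ :=
  Nat.count (fun s => key s = key t) t

theorem computable_occ {α : Type*} [Primcodable α] [DecidableEq α] {key : ℕ → α}
    (hk : Computable key) : Computable (occ key) := by
  have h : Computable fun t : ℕ => (Nat.rec 0
      (fun s ih => bif decide (key s = key t) then ih + 1 else ih) t : ℕ) := by
    refine Computable.nat_rec (f := fun t : ℕ => t) (g := fun _ => 0)
      (h := fun t (x : ℕ × ℕ) => bif decide (key x.1 = key t) then x.2 + 1 else x.2)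
      Computable.id (Computable.const 0) ?_
    have h1 : Computable fun x : ℕ × ℕ × ℕ => x.2.2 :=
      Computable.snd.comp Computable.snd
    have h2 : Computable fun x : ℕ × ℕ × ℕ => key x.2.1 :=
      hk.comp (Computable.fst.comp Computable.snd)
    exact Computable.cond (Computable.decide_eq h2 (hk.comp Computable.fst))
      (Computable.succ.comp h1) h1
  refine h.of_eq fun t => ?_
  have key_count : ∀ n : ℕ, (Nat.rec 0
      (fun s ih => bif decide (key s = key t) then ih + 1 else ih) n : ℕ) =
      Nat.count (fun s => key s = key t) n := by
    intro n
    induction n with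
    | zero => simp
    | succ n ih =>
      rw [Nat.count_succ, ← ih]
      by_cases hn : key n = key t <;> simp [hn]
  exact key_count t

theorem eq_of_occ_eq {α : Type*} [DecidableEq α] {key : ℕ → α} {s t : ℕ} (h : key s = key t)
    (ho : occ key s = occ key t) : s = t := by
  unfold occ at ho
  rw [h] at ho
  exact Nat.count_injective (p := fun i => key i = key t) h rfl ho

/-- An injective enumeration of the graph of the universal machine with the zero oracle. -/
structure IsGraphEnum (U : UniversalPrefixMachine) (E : ℕ → Option (BinStr × BinStr)) : Prop where
  computable : Computable E
  isPrefixCode : IsPrefixCode E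
  injective : ∀ s t r, E s = some r → E t = some r → s = t
  exists_eq : ∀ y, ∃ s p, E s = some (p, y) ∧ p.length = Kc U y

theorem exists_isGraphEnum (U : UniversalPrefixMachine) : ∃ E, IsGraphEnum U E := by
  classical
  let M := U.toPrefixOracleMachine
  let E₀ : ℕ → Option (BinStr × BinStr) := fun s =>
    (M.axioms s).bind fun r => bif decide (r.1 = restrict zeroSeq r.1.length) then some r.2 else none
  have hE₀ : ∀ s p y, E₀ s = some (p, y) ↔
      ∃ τ, M.axioms s = some (τ, p, y) ∧ τ = restrict zeroSeq τ.length := by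
    intro s p y
    simp only [E₀, Option.bind_eq_some_iff]
    constructor
    · rintro ⟨⟨τ, p', y'⟩, h, h'⟩
      by_cases hτ : τ = restrict zeroSeq τ.length
      · rw [← hτ] at h'
        simp only [decide_true, cond_true, Option.some.injEq, Prod.mk.injEq] at h'
        obtain ⟨rfl, rfl⟩ := h'
        exact ⟨τ, h, hτ⟩
      · simp [hτ] at h'
    · rintro ⟨τ, h, hτ⟩
      refine ⟨(τ, p, y), h, ?_⟩
      rw [← hτ]
      simp
  have hc₀ : Computable E₀ := by
    refine Computable.option_bind M.axioms_computable ?_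
    have hr : Primrec fun τ : BinStr => restrict zeroSeq τ.length :=
      Primrec.list_map (Primrec.list_range.comp Primrec.list_length) (Primrec₂.const false)
    have h : Primrec fun r : BinStr × BinStr × BinStr =>
        bif decide (r.1 = restrict zeroSeq r.1.length) then some r.2 else none :=
      Primrec.cond (Primrec.eq.decide.comp Primrec.fst (hr.comp Primrec.fst))
        (Primrec.option_some.comp Primrec.snd) (Primrec.const none)
    exact (h.to_comp.comp Computable.snd).to₂
  have hp₀ : IsPrefixCode E₀ := by
    intro s t p y q z hs ht hpq
    obtain ⟨τ₁, h₁, e₁⟩ := (hE₀ _ _ _).1 hs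
    obtain ⟨τ₂, h₂, e₂⟩ := (hE₀ _ _ _).1 ht
    refine M.consistent s t τ₁ p y τ₂ q z h₁ h₂ ?_ hpq
    have key : ∀ a b : ℕ, a ≤ b → restrict zeroSeq a <+: restrict zeroSeq b := by
      intro a b hab
      have h : List.range a <+: List.range b := by
        rw [← min_eq_left hab, ← List.take_range]
        exact List.take_prefix _ _
      exact h.map _
    rw [e₁, e₂]
    exact (le_total τ₁.length τ₂.length).imp (key _ _) (key _ _)
  let E : ℕ → Option (BinStr × BinStr) := fun s => bif decide (occ E₀ s = 0) then E₀ s else none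
  have hE : ∀ s r, E s = some r ↔ occ E₀ s = 0 ∧ E₀ s = some r := by
    intro s r
    by_cases h : occ E₀ s = 0 <;> simp [E, h]
  refine ⟨E, ?_, ?_, ?_, ?_⟩
  · exact Computable.cond (Computable.decide_eq (computable_occ hc₀) (Computable.const 0)) hc₀
      (Computable.const none)
  · intro s t p y q z hs ht
    exact hp₀ s t p y q z ((hE _ _).1 hs).2 ((hE _ _).1 ht).2
  · intro s t r hs ht
    obtain ⟨hs, hs'⟩ := (hE _ _).1 hs
    obtain ⟨ht, ht'⟩ := (hE _ _).1 ht
    exact eq_of_occ_eq (hs'.trans ht'.symm) (hs.trans ht.symm)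
  · intro y
    obtain ⟨p, hpl, s, τ, hs, n, rfl⟩ := exists_computes_length_eq_Kc U y
    have hs₀ : ∃ s, E₀ s = some (p, y) :=
      ⟨s, (hE₀ _ _ _).2 ⟨_, hs, by simp [restrict]⟩⟩
    refine ⟨Nat.find hs₀, p, (hE _ _).2 ⟨?_, Nat.find_spec hs₀⟩, hpl⟩
    rw [occ, Nat.count_iff_forall_not]
    intro m hm h
    exact Nat.find_min hs₀ hm (h.trans (Nat.find_spec hs₀))

/-- A prefix-free set of strings is uniquely decodable unless it contains the empty string. -/
theorem uniquelyDecodable_of_prefixFree {S : Set BinStr} (h0 : [] ∉ S)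
    (h : ∀ p ∈ S, ∀ q ∈ S, p <+: q → p = q) : InformationTheory.UniquelyDecodable S := by
  have hne : ∀ p ∈ S, p ≠ [] := fun p hp e => h0 (e ▸ hp)
  intro L₁
  induction L₁ with
  | nil =>
    intro L₂ _ h₂ hf
    cases L₂ with
    | nil => rfl
    | cons q L₂ =>
      have := hne q (h₂ q (by simp))
      simp at hf
      exact absurd hf.1 this
  | cons p L₁ ih =>
    intro L₂ h₁ h₂ hf
    cases L₂ with
    | nil =>
      have := hne p (h₁ p (by simp))
      simp at hf
      exact absurd hf.1 this
    | cons q L₂ =>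
      have hp := h₁ p (by simp)
      have hq := h₂ q (by simp)
      simp only [List.flatten_cons] at hf
      have hpq : p = q := by
        rcases List.prefix_or_prefix_of_prefix (List.prefix_append p L₁.flatten)
          (hf ▸ List.prefix_append q L₂.flatten) with h' | h'
        · exact h p hp q hq h'
        · exact (h q hq p hp h').symm
      subst hpq
      rw [ih L₂ (fun w hw => h₁ w (by simp [hw])) (fun w hw => h₂ w (by simp [hw]))
        (List.append_cancel_left hf)]

theorem kraft_inequality (S : Finset BinStr) (h : ∀ p ∈ S, ∀ q ∈ S, p <+: q → p = q) :
    ∑ p ∈ S, (1 / 2 : ℝ) ^ p.length ≤ 1 := by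
  by_cases h0 : [] ∈ S
  · have hS : S = {[]} := by
      ext q
      rw [Finset.mem_singleton]
      exact ⟨fun hq => (h [] h0 q hq (List.nil_prefix)).symm, fun hq => hq ▸ h0⟩
    simp [hS]
  · have := InformationTheory.kraft_mcmillan_inequality (S := S)
      (uniquelyDecodable_of_prefixFree (S := (S : Set BinStr)) (by simpa using h0) (by simpa using h))
    simpa using this

/-- The last `w` binary digits of `j`, most significant digit first. -/
def bits (w j : ℕ) : BinStr := (List.range w).map fun i => j.testBit (w - 1 - i)

@[simp] theorem length_bits (w j : ℕ) : (bits w j).length = w := by simp [bits]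

theorem eq_div_of_bits_isPrefix {w w' j j' : ℕ} (hj : j < 2 ^ w) (hj' : j' < 2 ^ w')
    (h : bits w j <+: bits w' j') : w ≤ w' ∧ j = j' / 2 ^ (w' - w) := by
  have hw : w ≤ w' := by simpa using h.length_le
  refine ⟨hw, Nat.eq_of_testBit_eq fun i => ?_⟩
  rw [Nat.testBit_div_two_pow]
  by_cases hi : i < w
  · have h1 := List.IsPrefix.getElem h (i := w - 1 - i) (by simp; omega)
    simp only [bits, List.getElem_map, List.getElem_range] at h1
    rw [show w - 1 - (w - 1 - i) = i by omega, show w' - 1 - (w - 1 - i) = i + (w' - w) by omega]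
      at h1
    exact h1
  · rw [Nat.testBit_eq_false_of_lt, Nat.testBit_eq_false_of_lt]
    · exact hj'.trans_le (Nat.pow_le_pow_right (by norm_num) (by omega))
    · exact hj.trans_le (Nat.pow_le_pow_right (by norm_num) (by omega))

theorem primrec_pow : Primrec₂ fun a b : ℕ => a ^ b :=
  (Primrec₂.unpaired'.1 Nat.Primrec.pow :)

theorem primrec_bits : Primrec₂ bits := by
  have h : Primrec₂ fun (x : ℕ × ℕ) (i : ℕ) => decide (x.2 / 2 ^ (x.1 - 1 - i) % 2 = 1) := by
    have e : Primrec fun y : (ℕ × ℕ) × ℕ => 2 ^ (y.1.1 - 1 - y.2) :=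
      primrec_pow.comp (Primrec.const 2) (Primrec.nat_sub.comp (Primrec.nat_sub.comp
        (Primrec.fst.comp Primrec.fst) (Primrec.const 1)) Primrec.snd)
    exact Primrec.eq.decide.comp (Primrec.nat_mod.comp (Primrec.nat_div.comp
      (Primrec.snd.comp Primrec.fst) e) (Primrec.const 2)) (Primrec.const 1)
  refine (Primrec.list_map (Primrec.list_range.comp Primrec.fst) h).of_eq fun x => ?_
  simp [bits, Nat.testBit_eq_decide_div_mod_eq]

/-- The weight `2 ^ (-l)` of a request for a program of length `l`. -/
noncomputable def requestWeight : Option (ℕ × BinStr) → ℝ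
  | none => 0
  | some r => (1 / 2) ^ r.1

theorem requestWeight_nonneg (o : Option (ℕ × BinStr)) : 0 ≤ requestWeight o := by
  cases o <;> simp [requestWeight]

/-- Adds the weight of a request to the dyadic rational `x.1 / 2 ^ x.2`. -/
def addRequest (x : ℕ × ℕ) (o : Option (ℕ × BinStr)) : ℕ × ℕ :=
  (o.map fun r => (x.1 * 2 ^ r.1 + 2 ^ x.2, x.2 + r.1)).getD x

theorem primrec_addRequest : Primrec₂ addRequest := by
  have h : Primrec₂ fun (y : (ℕ × ℕ) × Option (ℕ × BinStr)) (r : ℕ × BinStr) =>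
      (y.1.1 * 2 ^ r.1 + 2 ^ y.1.2, y.1.2 + r.1) := by
    have hx : Primrec fun z : ((ℕ × ℕ) × Option (ℕ × BinStr)) × ℕ × BinStr => z.1.1 :=
      Primrec.fst.comp Primrec.fst
    have hr : Primrec fun z : ((ℕ × ℕ) × Option (ℕ × BinStr)) × ℕ × BinStr => z.2.1 :=
      Primrec.fst.comp Primrec.snd
    exact Primrec.pair (Primrec.nat_add.comp
      (Primrec.nat_mul.comp (Primrec.fst.comp hx) (primrec_pow.comp (Primrec.const 2) hr))
      (primrec_pow.comp (Primrec.const 2) (Primrec.snd.comp hx)))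
      (Primrec.nat_add.comp (Primrec.snd.comp hx) hr)
  exact Primrec.option_getD.comp (Primrec.option_map Primrec.snd h) Primrec.fst

/-- The total weight `a / 2 ^ e` of the requests before stage `t`, as the pair `(a, e)`. -/
def requestSum (R : ℕ → Option (ℕ × BinStr)) (t : ℕ) : ℕ × ℕ :=
  Nat.rec (0, 0) (fun s x => addRequest x (R s)) t

theorem computable_requestSum {R : ℕ → Option (ℕ × BinStr)} (hR : Computable R) :
    Computable (requestSum R) := by
  have h : Computable₂ fun (_ : ℕ) (y : ℕ × ℕ × ℕ) => addRequest y.2 (R y.1) :=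
    primrec_addRequest.to_comp.comp (Computable.snd.comp Computable.snd)
      (hR.comp (Computable.fst.comp Computable.snd))
  exact Computable.nat_rec Computable.id (Computable.const _) h

theorem requestSum_eq (R : ℕ → Option (ℕ × BinStr)) (t : ℕ) :
    ((requestSum R t).1 : ℝ) / 2 ^ (requestSum R t).2 =
      ∑ s ∈ Finset.range t, requestWeight (R s) := by
  induction t with
  | zero => simp [requestSum]
  | succ t ih =>
    rw [Finset.sum_range_succ, ← ih]
    have h : requestSum R (t + 1) = addRequest (requestSum R t) (R t) := rfl
    rw [h, addRequest]
    cases R t with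
    | none => simp [requestWeight]
    | some r =>
      simp only [requestWeight, Option.map_some, Option.getD_some, Nat.cast_add, Nat.cast_mul,
        Nat.cast_pow, Nat.cast_ofNat, pow_add, one_div, inv_pow]
      field_simp

/-- Online allocation of programs: a request of length `l` made when the previous requests have
total weight `x` receives the first dyadic interval of length `2 ^ (-(l + 1))` above `x`. -/
def requestCode (R : ℕ → Option (ℕ × BinStr)) (t : ℕ) : Option (BinStr × BinStr) :=
  (R t).map fun r => (bits (r.1 + 1) (((requestSum R t).1 * 2 ^ (r.1 + 1) +
    2 ^ (requestSum R t).2 - 1) / 2 ^ (requestSum R t).2), r.2)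

theorem computable_requestCode {R : ℕ → Option (ℕ × BinStr)} (hR : Computable R) :
    Computable (requestCode R) := by
  have h : Primrec fun z : (ℕ × ℕ) × ℕ × BinStr =>
      (bits (z.2.1 + 1) ((z.1.1 * 2 ^ (z.2.1 + 1) + 2 ^ z.1.2 - 1) / 2 ^ z.1.2), z.2.2) := by
    have hl : Primrec fun z : (ℕ × ℕ) × ℕ × BinStr => z.2.1 + 1 :=
      Primrec.succ.comp (Primrec.fst.comp Primrec.snd)
    have he : Primrec fun z : (ℕ × ℕ) × ℕ × BinStr => 2 ^ z.1.2 :=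
      primrec_pow.comp (Primrec.const 2) (Primrec.snd.comp Primrec.fst)
    have ha : Primrec fun z : (ℕ × ℕ) × ℕ × BinStr => z.1.1 * 2 ^ (z.2.1 + 1) :=
      Primrec.nat_mul.comp (Primrec.fst.comp Primrec.fst) (primrec_pow.comp (Primrec.const 2) hl)
    exact Primrec.pair (primrec_bits.comp hl (Primrec.nat_div.comp
      (Primrec.nat_sub.comp (Primrec.nat_add.comp ha he) (Primrec.const 1)) he))
      (Primrec.snd.comp Primrec.snd)
  exact Computable.option_map hR (h.to_comp.comp (Computable.pair
    ((computable_requestSum hR).comp Computable.fst) Computable.snd)).to₂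

theorem ceilDiv_bounds (a e l : ℕ) :
    (a : ℝ) / 2 ^ e ≤ (((a * 2 ^ l + 2 ^ e - 1) / 2 ^ e : ℕ) : ℝ) / 2 ^ l ∧
      ((((a * 2 ^ l + 2 ^ e - 1) / 2 ^ e : ℕ) : ℝ) + 1) / 2 ^ l < (a : ℝ) / 2 ^ e + 2 / 2 ^ l := by
  set j := (a * 2 ^ l + 2 ^ e - 1) / 2 ^ e with hj
  have he : 0 < 2 ^ e := by positivity
  have h1 : a * 2 ^ l ≤ j * 2 ^ e := by
    have := Nat.lt_div_mul_add (a := a * 2 ^ l + 2 ^ e - 1) he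
    rw [← hj] at this
    omega
  have h2 : j * 2 ^ e < a * 2 ^ l + 2 ^ e := by
    have := Nat.div_mul_le_self (a * 2 ^ l + 2 ^ e - 1) (2 ^ e)
    rw [← hj] at this
    omega
  have h1' : (a : ℝ) * 2 ^ l ≤ j * 2 ^ e := by exact_mod_cast h1
  have h2' : (j : ℝ) * 2 ^ e < a * 2 ^ l + 2 ^ e := by exact_mod_cast h2
  constructor
  · rw [div_le_div_iff₀ (by positivity) (by positivity)]
    exact h1'
  · rw [div_add_div _ _ (by positivity) (by positivity), div_lt_div_iff₀ (by positivity)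
      (by positivity)]
    have : (0 : ℝ) < 2 ^ l := by positivity
    nlinarith

theorem isPrefixCode_requestCode {R : ℕ → Option (ℕ × BinStr)}
    (hR : ∀ t, ∑ s ∈ Finset.range t, requestWeight (R s) ≤ 1) : IsPrefixCode (requestCode R) := by
  set S : ℕ → ℝ := fun t => ∑ s ∈ Finset.range t, requestWeight (R s) with hS
  have hmono : Monotone S := by
    refine monotone_nat_of_le_succ fun t => ?_
    simp only [hS, Finset.sum_range_succ]
    linarith [requestWeight_nonneg (R t)]
  have hcode : ∀ t p y, requestCode R t = some (p, y) → ∃ l j : ℕ, R t = some (l, y) ∧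
      p = bits (l + 1) j ∧ j < 2 ^ (l + 1) ∧ S t ≤ (j : ℝ) / 2 ^ (l + 1) ∧
      ((j : ℝ) + 1) / 2 ^ (l + 1) ≤ S (t + 1) := by
    intro t p y h
    simp only [requestCode, Option.map_eq_some_iff, Prod.mk.injEq] at h
    obtain ⟨⟨l, y'⟩, hRt, rfl, rfl⟩ := h
    have hb := ceilDiv_bounds (requestSum R t).1 (requestSum R t).2 (l + 1)
    rw [requestSum_eq] at hb
    have hS1 : S (t + 1) = S t + 2 / 2 ^ (l + 1) := by
      have h2 : requestWeight (R t) = 2 / 2 ^ (l + 1) := by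
        rw [hRt, pow_succ]
        simp only [requestWeight, one_div, inv_pow]
        field_simp
      simp only [hS, Finset.sum_range_succ, h2]
    refine ⟨l, _, hRt, rfl, ?_, hb.1, hS1 ▸ hb.2.le⟩
    have h3 := hb.2.le.trans (hS1.symm.le.trans (hR (t + 1)))
    rw [div_le_one (by positivity)] at h3
    exact_mod_cast h3
  intro s t p y q z hs ht hpq
  obtain ⟨l, j, hRs, rfl, hj, hlo, hhi⟩ := hcode s p y hs
  obtain ⟨l', j', hRt, rfl, hj', hlo', hhi'⟩ := hcode t q z ht
  obtain ⟨hl, hjj⟩ := eq_div_of_bits_isPrefix hj hj' hpq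
  obtain ⟨d, hd⟩ := Nat.exists_eq_add_of_le hl
  rw [hd, Nat.add_sub_cancel_left] at hjj
  have hd0 : 0 < 2 ^ d := by positivity
  have h1 : j * 2 ^ d ≤ j' := hjj ▸ Nat.div_mul_le_self _ _
  have h2 : j' < (j + 1) * 2 ^ d := by
    have := Nat.lt_div_mul_add (a := j') hd0
    rw [← hjj] at this
    linarith
  have h1' : (j : ℝ) * 2 ^ d ≤ j' := by exact_mod_cast h1
  have h2' : (j' : ℝ) < (j + 1) * 2 ^ d := by exact_mod_cast h2
  have hst : s = t := by
    have e1 : (j : ℝ) / 2 ^ (l + 1) ≤ j' / 2 ^ (l' + 1) := by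
      rw [hd, pow_add _ _ d, div_le_div_iff₀ (by positivity) (by positivity)]
      have : (0 : ℝ) < 2 ^ (l + 1) := by positivity
      nlinarith
    have e2 : (j' : ℝ) / 2 ^ (l' + 1) < (j + 1) / 2 ^ (l + 1) := by
      rw [hd, pow_add _ _ d, div_lt_div_iff₀ (by positivity) (by positivity)]
      have : (0 : ℝ) < 2 ^ (l + 1) := by positivity
      nlinarith
    have e3 : (j' : ℝ) / 2 ^ (l' + 1) < (j' + 1) / 2 ^ (l' + 1) := by
      gcongr
      linarith
    rcases lt_trichotomy s t with h | h | h
    · have := hmono (show s + 1 ≤ t from h)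
      linarith
    · exact h
    · have := hmono (show t + 1 ≤ s from h)
      linarith
  subst hst
  rw [hs] at ht
  simpa using ht

/-- The Kraft–Chaitin theorem, up to a constant. -/
theorem exists_Kc_le_of_requests (U : UniversalPrefixMachine) {R : ℕ → Option (ℕ × BinStr)}
    (hc : Computable R) (hR : ∀ t, ∑ s ∈ Finset.range t, requestWeight (R s) ≤ 1) :
    ∃ c, ∀ t l y, R t = some (l, y) → Kc U y ≤ l + c := by
  obtain ⟨c, h⟩ := (isPrefixCode_requestCode hR).exists_Kc_le U (computable_requestCode hc)
  refine ⟨c + 1, fun t l y ht => ?_⟩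
  have := h t _ y (by rw [requestCode, ht, Option.map_some])
  rw [length_bits] at this
  omega

/-- The program length and the output length at each stage of an enumeration. -/
def sizeKey (E : ℕ → Option (BinStr × BinStr)) (t : ℕ) : Option (ℕ × ℕ) :=
  (E t).map fun r => (r.1.length, r.2.length)

theorem computable_sizeKey {E : ℕ → Option (BinStr × BinStr)} (hE : Computable E) :
    Computable (sizeKey E) :=
  Computable.option_map hE (Primrec.to_comp (Primrec.pair
    (Primrec.list_length.comp (Primrec.fst.comp Primrec.snd))
    (Primrec.list_length.comp (Primrec.snd.comp Primrec.snd)))).to₂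

/-- The weight of a program as a function of its size key. -/
noncomputable def keyWeight : Option (ℕ × ℕ) → ℝ
  | none => 0
  | some x => (1 / 2) ^ x.1

theorem keyWeight_nonneg (o : Option (ℕ × ℕ)) : 0 ≤ keyWeight o := by
  cases o <;> simp [keyWeight]

theorem sum_keyWeight_le_one {E : ℕ → Option (BinStr × BinStr)} (hp : IsPrefixCode E)
    (hi : ∀ s t r, E s = some r → E t = some r → s = t) (T : ℕ) :
    ∑ t ∈ Finset.range T, keyWeight (sizeKey E t) ≤ 1 := by
  classical
  let f : ℕ → BinStr := fun t => ((E t).map Prod.fst).getD []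
  let I := (Finset.range T).filter fun t => (E t).isSome
  have hI : ∀ t ∈ I, ∃ y, E t = some (f t, y) := by
    intro t ht
    obtain ⟨⟨p, y⟩, hr⟩ := Option.isSome_iff_exists.1 (Finset.mem_filter.1 ht).2
    exact ⟨y, by simp [f, hr]⟩
  have hf : Set.InjOn f I := by
    intro s hs t ht hst
    obtain ⟨y, hy⟩ := hI s hs
    obtain ⟨z, hz⟩ := hI t ht
    obtain ⟨h1, h2⟩ := hp s t _ _ _ _ hy hz (hst ▸ List.prefix_refl _)
    exact hi s t _ hy (by rw [hz, h1, h2])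
  have hsum : ∑ t ∈ Finset.range T, keyWeight (sizeKey E t) =
      ∑ p ∈ I.image f, (1 / 2 : ℝ) ^ p.length := by
    rw [Finset.sum_image hf, Finset.sum_filter]
    refine Finset.sum_congr rfl fun t _ => ?_
    cases h : E t <;> simp [sizeKey, keyWeight, h, f]
  rw [hsum]
  refine kraft_inequality _ fun p hp' q hq' hpq => ?_
  obtain ⟨s, hs, rfl⟩ := Finset.mem_image.1 hp'
  obtain ⟨t, ht, rfl⟩ := Finset.mem_image.1 hq'
  obtain ⟨y, hy⟩ := hI s hs
  obtain ⟨z, hz⟩ := hI t ht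
  exact (hp s t _ _ _ _ hy hz hpq).1

theorem sum_block_add_count_mod (P : ℕ → Prop) [DecidablePred P] {M : ℕ} (hM : 0 < M) (T : ℕ) :
    (∑ t ∈ Finset.range T, if P t ∧ (Nat.count P t + 1) % M = 0 then M else 0) +
      Nat.count P T % M = Nat.count P T := by
  induction T with
  | zero => simp
  | succ T ih =>
    rw [Finset.sum_range_succ, Nat.count_succ]
    by_cases hP : P T
    · simp only [hP, true_and, if_true]
      set c := Nat.count P T
      have hlt := Nat.mod_lt c hM
      rcases eq_or_ne (c % M + 1) M with h | h
      · have h0 : (c + 1) % M = 0 := by rw [← Nat.mod_add_mod, h, Nat.mod_self]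
        rw [if_pos h0, h0]
        omega
      · have h0 : (c + 1) % M = c % M + 1 := by
          rw [← Nat.mod_add_mod, Nat.mod_eq_of_lt (by omega)]
        rw [if_neg (by omega), h0]
        omega
    · simpa [hP] using ih

/-- Selecting one occurrence out of every `M` equal keys, with `M` times the weight, does not
increase the total weight. -/
theorem sum_block_le {α : Type*} [DecidableEq α] (key : ℕ → α) (v : α → ℝ) (hv : ∀ a, 0 ≤ v a)
    {M : ℕ} (hM : 0 < M) (T : ℕ) :
    ∑ t ∈ Finset.range T, (if (occ key t + 1) % M = 0 then (M : ℝ) * v (key t) else 0) ≤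
      ∑ t ∈ Finset.range T, v (key t) := by
  have hmap : ∀ t ∈ Finset.range T, key t ∈ (Finset.range T).image key :=
    fun t ht => Finset.mem_image_of_mem _ ht
  rw [← Finset.sum_fiberwise_of_maps_to hmap, ← Finset.sum_fiberwise_of_maps_to hmap]
  refine Finset.sum_le_sum fun a _ => ?_
  have h1 : ∑ t ∈ Finset.range T with key t = a,
      (if (occ key t + 1) % M = 0 then (M : ℝ) * v (key t) else 0) =
      ((∑ t ∈ Finset.range T, if key t = a ∧ (Nat.count (fun s => key s = a) t + 1) % M = 0
        then M else 0 : ℕ) : ℝ) * v a := by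
    rw [Finset.sum_filter, Nat.cast_sum, Finset.sum_mul]
    refine Finset.sum_congr rfl fun t _ => ?_
    by_cases h : key t = a
    · subst h
      rw [← occ]
      by_cases h0 : (occ key t + 1) % M = 0 <;> simp [h0]
    · simp [h]
  have h2 : ∑ t ∈ Finset.range T with key t = a, v (key t) =
      (Nat.count (fun s => key s = a) T : ℝ) * v a := by
    rw [Nat.count_eq_card_filter_range, ← nsmul_eq_mul, ← Finset.sum_const]
    exact Finset.sum_congr rfl fun t ht => by rw [(Finset.mem_filter.1 ht).2]
  rw [h1, h2]
  refine mul_le_mul_of_nonneg_right ?_ (hv a)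
  exact_mod_cast le_of_add_le_left (sum_block_add_count_mod (fun s => key s = a) hM T).le

theorem exists_count_eq (P : ℕ → Prop) [DecidablePred P] {m T : ℕ} (h : m < Nat.count P T) :
    ∃ t < T, P t ∧ Nat.count P t = m := by
  induction T with
  | zero => simp at h
  | succ T ih =>
    rw [Nat.count_succ] at h
    by_cases hP : P T
    · rcases eq_or_ne (Nat.count P T) m with h' | h'
      · exact ⟨T, T.lt_succ_self, hP, h'⟩
      · obtain ⟨t, ht, h''⟩ := ih (by simp [hP] at h; omega)
        exact ⟨t, ht.trans T.lt_succ_self, h''⟩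
    · obtain ⟨t, ht, h''⟩ := ih (by simpa [hP] using h)
      exact ⟨t, ht.trans T.lt_succ_self, h''⟩

/-- For each `k`, request a program of length `l - k + 1` for the string of `n` zeros whenever
another `4 ^ k` programs of length `l` with outputs of length `n` have been enumerated. -/
def blockRequest (E : ℕ → Option (BinStr × BinStr)) (k t : ℕ) : Option (ℕ × BinStr) :=
  bif decide ((occ (sizeKey E) t + 1) % 4 ^ k = 0) then
    (E t).map fun r => (r.1.length - k + 1, r.2.map fun _ => false)
  else none

theorem computable_blockRequest {E : ℕ → Option (BinStr × BinStr)} (hE : Computable E) :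
    Computable₂ (blockRequest E) := by
  have h : Primrec fun z : (ℕ × ℕ) × BinStr × BinStr =>
      (z.2.1.length - z.1.1 + 1, z.2.2.map fun _ => false) :=
    Primrec.pair (Primrec.succ.comp (Primrec.nat_sub.comp
      (Primrec.list_length.comp (Primrec.fst.comp Primrec.snd)) (Primrec.fst.comp Primrec.fst)))
      (Primrec.list_map (Primrec.snd.comp Primrec.snd) (Primrec₂.const false))
  exact Computable.cond (Computable.decide_eq (Primrec.nat_mod.to_comp.comp
      (Computable.succ.comp ((computable_occ (computable_sizeKey hE)).comp Computable.snd))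
      (primrec_pow.to_comp.comp (Computable.const 4) Computable.fst)) (Computable.const 0))
    (Computable.option_map (hE.comp Computable.snd) h.to_comp.to₂) (Computable.const none)

theorem sum_block_keyWeight_le_one {E : ℕ → Option (BinStr × BinStr)}
    (hsum : ∀ T, ∑ t ∈ Finset.range T, keyWeight (sizeKey E t) ≤ 1) (k T : ℕ) :
    ∑ t ∈ Finset.range T, (if (occ (sizeKey E) t + 1) % 4 ^ k = 0 then
      (4 : ℝ) ^ k * keyWeight (sizeKey E t) else 0) ≤ 1 := by
  refine le_trans ?_ (hsum T)
  simpa using sum_block_le (sizeKey E) keyWeight keyWeight_nonneg (M := 4 ^ k) (by positivity) T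

theorem two_mul_le_of_block {E : ℕ → Option (BinStr × BinStr)}
    (hsum : ∀ T, ∑ t ∈ Finset.range T, keyWeight (sizeKey E t) ≤ 1) {k t : ℕ}
    {r : BinStr × BinStr} (hk : (occ (sizeKey E) t + 1) % 4 ^ k = 0) (ht : E t = some r) : 2 * k ≤ r.1.length := by
  have h := (Finset.single_le_sum (f := fun t => if (occ (sizeKey E) t + 1) % 4 ^ k = 0 then
      (4 : ℝ) ^ k * keyWeight (sizeKey E t) else 0)
    (fun i _ => by
      have := keyWeight_nonneg (sizeKey E i)
      positivity) (Finset.self_mem_range_succ t)).trans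
    (sum_block_keyWeight_le_one hsum k (t + 1))
  simp only [hk, if_true, sizeKey, ht, Option.map_some, keyWeight, one_div, inv_pow] at h
  rw [← div_eq_mul_inv, div_le_one (by positivity), show (4 : ℝ) = 2 ^ 2 by norm_num,
    ← pow_mul] at h
  exact (pow_le_pow_iff_right₀ (by norm_num : (1 : ℝ) < 2)).1 h

theorem sum_blockRequest_le {E : ℕ → Option (BinStr × BinStr)}
    (hsum : ∀ T, ∑ t ∈ Finset.range T, keyWeight (sizeKey E t) ≤ 1) (k T : ℕ) :
    ∑ t ∈ Finset.range T, requestWeight (blockRequest E k t) ≤ (1 / 2) ^ (k + 1) := by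
  refine le_trans ?_ (mul_le_of_le_one_right (by positivity : (0 : ℝ) ≤ (1 / 2) ^ (k + 1))
    (sum_block_keyWeight_le_one hsum k T))
  rw [Finset.mul_sum]
  refine Finset.sum_le_sum fun t _ => ?_
  by_cases hk : (occ (sizeKey E) t + 1) % 4 ^ k = 0
  · cases ht : E t with
    | none => simp [blockRequest, hk, ht, requestWeight, sizeKey, keyWeight]
    | some r =>
      have hl := two_mul_le_of_block hsum hk ht
      obtain ⟨m, hm⟩ := Nat.exists_eq_add_of_le hl
      have e : 2 * k + m - k + 1 = k + m + 1 := by omega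
      simp only [blockRequest, hk, decide_true, cond_true, ht, Option.map_some, requestWeight,
        sizeKey, keyWeight, if_true, hm, e]
      rw [show (4 : ℝ) = 2 ^ 2 by norm_num, ← pow_mul]
      simp only [one_div, inv_pow, pow_add]
      apply le_of_eq
      field_simp
  · simp [blockRequest, hk, requestWeight]

theorem sum_blockRequest_unpair_le_one {E : ℕ → Option (BinStr × BinStr)}
    (hsum : ∀ T, ∑ t ∈ Finset.range T, keyWeight (sizeKey E t) ≤ 1) (T : ℕ) :
    ∑ u ∈ Finset.range T, requestWeight (blockRequest E u.unpair.1 u.unpair.2) ≤ 1 := by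
  classical
  calc ∑ u ∈ Finset.range T, requestWeight (blockRequest E u.unpair.1 u.unpair.2)
      = ∑ x ∈ (Finset.range T).image Nat.unpair, requestWeight (blockRequest E x.1 x.2) := by
        exact (Finset.sum_image (f := fun x : ℕ × ℕ => requestWeight (blockRequest E x.1 x.2))
          (Nat.pairEquiv.symm.injective.injOn)).symm
    _ ≤ ∑ x ∈ Finset.range T ×ˢ Finset.range T, requestWeight (blockRequest E x.1 x.2) := by
        refine Finset.sum_le_sum_of_subset_of_nonneg ?_ fun _ _ _ => requestWeight_nonneg _
        intro x hx
        obtain ⟨u, hu, rfl⟩ := Finset.mem_image.1 hx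
        rw [Finset.mem_range] at hu
        simp only [Finset.mem_product, Finset.mem_range]
        exact ⟨(Nat.unpair_left_le u).trans_lt hu, (Nat.unpair_right_le u).trans_lt hu⟩
    _ = ∑ k ∈ Finset.range T, ∑ t ∈ Finset.range T, requestWeight (blockRequest E k t) :=
        Finset.sum_product _ _ _
    _ ≤ ∑ k ∈ Finset.range T, (1 / 2 : ℝ) ^ (k + 1) :=
        Finset.sum_le_sum fun k _ => sum_blockRequest_le hsum k T
    _ ≤ 1 := by
        have h : ∀ N, ∑ k ∈ Finset.range N, (1 / 2 : ℝ) ^ (k + 1) = 1 - (1 / 2) ^ N := by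
          intro N
          induction N with
          | zero => simp
          | succ N ih => rw [Finset.sum_range_succ, ih]; ring
        rw [h]
        have : (0 : ℝ) ≤ (1 / 2) ^ T := by positivity
        linarith

/-- The counting theorem: there are `O(4 ^ e)` programs of length at most `K(n) + e` with an output
of length `n`, in each length. -/
theorem exists_occ_lt {U : UniversalPrefixMachine} {E : ℕ → Option (BinStr × BinStr)}
    (hE : IsGraphEnum U E) : ∃ D, ∀ t p y e, E t = some (p, y) →
      p.length ≤ KcNat U y.length + e → occ (sizeKey E) t < 2 ^ (2 * (e + D)) := by
  have hsum := sum_keyWeight_le_one hE.isPrefixCode hE.injective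
  obtain ⟨c, hc⟩ := exists_Kc_le_of_requests U
    (R := fun u => blockRequest E u.unpair.1 u.unpair.2)
    ((computable_blockRequest hE.computable).comp
      (Primrec.fst.comp Primrec.unpair).to_comp (Primrec.snd.comp Primrec.unpair).to_comp)
    (sum_blockRequest_unpair_le_one hsum)
  refine ⟨c + 2, fun t p y e ht hp => ?_⟩
  by_contra! hocc
  rw [pow_mul, show 2 ^ 2 = 4 by norm_num] at hocc
  set k := e + (c + 2) with hk
  have h4 : 0 < 4 ^ k := by positivity
  obtain ⟨s, -, hs, hcount⟩ := exists_count_eq (fun s => sizeKey E s = sizeKey E t)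
    (m := 4 ^ k - 1) (T := t) (by rw [occ] at hocc; omega)
  have hmod : (occ (sizeKey E) s + 1) % 4 ^ k = 0 := by
    rw [occ, hs, hcount, Nat.sub_add_cancel h4, Nat.mod_self]
  simp only [sizeKey, ht, Option.map_some, Option.map_eq_some_iff, Prod.mk.injEq] at hs
  obtain ⟨r, hr, hl, hn⟩ := hs
  have h2k := two_mul_le_of_block hsum hmod hr
  have := hc (Nat.pair k s) (r.1.length - k + 1) (r.2.map fun _ => false)
    (by simp [blockRequest, hmod, hr])
  rw [List.map_const', hn] at this
  change KcNat U y.length ≤ _ at this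
  omega

/-- Applying a computable function to a string increases its complexity by at most a constant. -/
theorem exists_Kc_comp_le (U : UniversalPrefixMachine) {f : BinStr → BinStr} (hf : Computable f) :
    ∃ c, ∀ y, Kc U (f y) ≤ Kc U y + c := by
  obtain ⟨E, hE⟩ := exists_isGraphEnum U
  have hp : IsPrefixCode fun s => (E s).map fun r => (r.1, f r.2) := by
    intro s t p y q z hs ht hpq
    simp only [Option.map_eq_some_iff, Prod.mk.injEq] at hs ht
    obtain ⟨r, hr, rfl, rfl⟩ := hs
    obtain ⟨r', hr', rfl, rfl⟩ := ht
    obtain ⟨h1, h2⟩ := hE.isPrefixCode s t _ _ _ _ hr hr' hpq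
    exact ⟨h1, h2 ▸ rfl⟩
  obtain ⟨c, hc⟩ := hp.exists_Kc_le U (Computable.option_map hE.computable (Computable.pair
    (Computable.fst.comp Computable.snd) (hf.comp (Computable.snd.comp Computable.snd))).to₂)
  refine ⟨c, fun y => ?_⟩
  obtain ⟨s, p, hs, hl⟩ := hE.exists_eq y
  exact hl ▸ hc s p (f y) (by simp [hs])

/-- A prefix-free code for the pairs `(e, i)` with `i < 2 ^ (2 * (e + D))`. -/
def pairCode (D e i : ℕ) : BinStr := List.replicate e true ++ false :: bits (2 * (e + D)) i

theorem length_pairCode (D e i : ℕ) : (pairCode D e i).length = 3 * e + 2 * D + 1 := by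
  simp [pairCode]
  omega

theorem eq_and_prefix_of_replicate_isPrefix {e e' : ℕ} {x x' : BinStr}
    (h : List.replicate e true ++ false :: x <+: List.replicate e' true ++ false :: x') :
    e = e' ∧ x <+: x' := by
  induction e generalizing e' with
  | zero => cases e' <;> simp_all [List.replicate_succ, List.cons_prefix_cons]
  | succ e ih =>
    cases e' with
    | zero => simp [List.replicate_succ, List.cons_prefix_cons] at h
    | succ e' =>
      simp only [List.replicate_succ, List.cons_append, List.cons_prefix_cons, true_and] at h
      obtain ⟨h1, h2⟩ := ih h
      exact ⟨by rw [h1], h2⟩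

theorem eq_of_pairCode_isPrefix {D e e' i i' : ℕ} (hi : i < 2 ^ (2 * (e + D)))
    (hi' : i' < 2 ^ (2 * (e' + D))) (h : pairCode D e i <+: pairCode D e' i') :
    e = e' ∧ i = i' := by
  obtain ⟨rfl, h⟩ := eq_and_prefix_of_replicate_isPrefix h
  exact ⟨rfl, by simpa using (eq_div_of_bits_isPrefix hi hi' h).2⟩

theorem primrec_pairCode (D : ℕ) : Primrec₂ (pairCode D) := by
  have h : Primrec₂ fun e i : ℕ =>
      (List.range e).map (fun _ => true) ++ false :: bits (2 * (e + D)) i :=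
    Primrec.list_append.comp
      (Primrec.list_map (Primrec.list_range.comp Primrec.fst) (Primrec₂.const true))
      (Primrec.list_cons.comp (Primrec.const false) (primrec_bits.comp
        (Primrec.nat_mul.comp (Primrec.const 2) (Primrec.nat_add.comp Primrec.fst
          (Primrec.const D))) Primrec.snd))
  exact h.of_eq fun e i => by simp [pairCode]

/-- Given a pair `r = (p, y)`, the code of stage `s` of `E` among the programs that have the same
length as the program at stage `s` and an output as long as `y`. -/
def indexCode (E : ℕ → Option (BinStr × BinStr)) (d D : ℕ) (r : BinStr × BinStr) (s : ℕ) :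
    Option (BinStr × BinStr) :=
  (E s).bind fun q =>
    bif decide (q.2.length = r.2.length) && decide (r.1.length ≤ q.1.length + d) &&
        decide (occ (sizeKey E) s + 1 ≤ 2 ^ (2 * (q.1.length + d - r.1.length + D))) then
      some (pairCode D (q.1.length + d - r.1.length) (occ (sizeKey E) s), q.2)
    else none

theorem indexCode_eq_some_iff {E : ℕ → Option (BinStr × BinStr)} {d D : ℕ} {r x : BinStr × BinStr}
    {s : ℕ} : indexCode E d D r s = some x ↔ ∃ p e, E s = some (p, x.2) ∧
      x.2.length = r.2.length ∧ p.length + d = r.1.length + e ∧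
      occ (sizeKey E) s < 2 ^ (2 * (e + D)) ∧ x.1 = pairCode D e (occ (sizeKey E) s) := by
  obtain ⟨b, y⟩ := x
  simp only [indexCode, Option.bind_eq_some_iff]
  constructor
  · rintro ⟨⟨p, y'⟩, hs, h⟩
    simp only [Bool.cond_eq_ite, Bool.and_eq_true, decide_eq_true_eq, Option.ite_none_right_eq_some,
      Option.some.injEq, Prod.mk.injEq] at h
    obtain ⟨⟨⟨h1, h2⟩, h3⟩, rfl, rfl⟩ := h
    exact ⟨p, p.length + d - r.1.length, hs, h1, by omega, h3, rfl⟩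
  · rintro ⟨p, e, hs, h1, h2, h3, rfl⟩
    refine ⟨(p, y), hs, ?_⟩
    obtain rfl : e = p.length + d - r.1.length := by omega
    simp only [Bool.cond_eq_ite, Bool.and_eq_true, decide_eq_true_eq, Option.ite_none_right_eq_some]
    exact ⟨⟨⟨h1, by omega⟩, h3⟩, trivial⟩

theorem indexCode_inj {E : ℕ → Option (BinStr × BinStr)} {d D : ℕ} {r x x' : BinStr × BinStr}
    {s s' : ℕ} (h : indexCode E d D r s = some x) (h' : indexCode E d D r s' = some x')
    (hx : x.1 <+: x'.1 ∨ x'.1 <+: x.1) : x = x' := by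
  have key : s = s' := by
    obtain ⟨p, e, hs, h1, h2, h3, h4⟩ := indexCode_eq_some_iff.1 h
    obtain ⟨p', e', hs', h1', h2', h3', h4'⟩ := indexCode_eq_some_iff.1 h'
    rw [h4, h4'] at hx
    have he : e = e' ∧ occ (sizeKey E) s = occ (sizeKey E) s' := by
      rcases hx with hx | hx
      · exact eq_of_pairCode_isPrefix h3 h3' hx
      · exact (eq_of_pairCode_isPrefix h3' h3 hx).imp Eq.symm Eq.symm
    refine eq_of_occ_eq ?_ he.2
    have hl : p.length = p'.length := by omega
    simp [sizeKey, hs, hs', hl, h1, h1']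
  subst key
  exact Option.some.inj (h.symm.trans h')

theorem computable_indexCode {E : ℕ → Option (BinStr × BinStr)} (hE : Computable E) (d D : ℕ) :
    Computable₂ (indexCode E d D) := by
  have h : Primrec fun z : (BinStr × BinStr) × (BinStr × BinStr) × ℕ =>
      bif decide (z.2.1.2.length = z.1.2.length) && decide (z.1.1.length ≤ z.2.1.1.length + d) &&
        decide (z.2.2 + 1 ≤ 2 ^ (2 * (z.2.1.1.length + d - z.1.1.length + D))) then
      some (pairCode D (z.2.1.1.length + d - z.1.1.length) z.2.2, z.2.1.2)
    else none := by
    have hq : Primrec fun z : (BinStr × BinStr) × (BinStr × BinStr) × ℕ => z.2.1 :=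
      Primrec.fst.comp Primrec.snd
    have hi : Primrec fun z : (BinStr × BinStr) × (BinStr × BinStr) × ℕ => z.2.2 :=
      Primrec.snd.comp Primrec.snd
    have hr₁ : Primrec fun z : (BinStr × BinStr) × (BinStr × BinStr) × ℕ => z.1.1.length :=
      Primrec.list_length.comp (Primrec.fst.comp Primrec.fst)
    have hr₂ : Primrec fun z : (BinStr × BinStr) × (BinStr × BinStr) × ℕ => z.1.2.length :=
      Primrec.list_length.comp (Primrec.snd.comp Primrec.fst)
    have hqd : Primrec fun z : (BinStr × BinStr) × (BinStr × BinStr) × ℕ => z.2.1.1.length + d :=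
      Primrec.nat_add.comp (Primrec.list_length.comp (Primrec.fst.comp hq)) (Primrec.const d)
    have he : Primrec fun z : (BinStr × BinStr) × (BinStr × BinStr) × ℕ =>
        z.2.1.1.length + d - z.1.1.length := Primrec.nat_sub.comp hqd hr₁
    have hpow : Primrec fun z : (BinStr × BinStr) × (BinStr × BinStr) × ℕ =>
        2 ^ (2 * (z.2.1.1.length + d - z.1.1.length + D)) :=
      primrec_pow.comp (Primrec.const 2) (Primrec.nat_mul.comp (Primrec.const 2)
        (Primrec.nat_add.comp he (Primrec.const D)))
    exact Primrec.cond (Primrec.and.comp (Primrec.and.comp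
        (Primrec.eq.decide.comp (Primrec.list_length.comp (Primrec.snd.comp hq)) hr₂)
        (Primrec.nat_le.decide.comp hr₁ hqd))
        (Primrec.nat_le.decide.comp (Primrec.succ.comp hi) hpow))
      (Primrec.option_some.comp (Primrec.pair ((primrec_pairCode D).comp he hi)
        (Primrec.snd.comp hq))) (Primrec.const none)
  exact Computable.option_bind (hE.comp Computable.snd) (h.to_comp.comp (Computable.pair
    (Computable.fst.comp Computable.fst) (Computable.pair Computable.snd
      ((computable_occ (computable_sizeKey hE)).comp
        (Computable.snd.comp Computable.fst))))).to₂

/-- The initial segment of length `a.length` of the join of two strings. -/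
def joinStr (a b : BinStr) : BinStr :=
  (List.range a.length).map fun i =>
    bif decide (i % 2 = 0) then a.getD (i / 2) false else b.getD (i / 2) false

theorem primrec_joinStr : Primrec₂ joinStr := by
  have hi : Primrec fun z : (BinStr × BinStr) × ℕ => z.2 / 2 :=
    Primrec.nat_div.comp Primrec.snd (Primrec.const 2)
  exact Primrec.list_map (Primrec.list_range.comp (Primrec.list_length.comp Primrec.fst))
    (Primrec.cond (Primrec.eq.decide.comp (Primrec.nat_mod.comp Primrec.snd (Primrec.const 2))
      (Primrec.const 0))
      ((Primrec.list_getD false).comp (Primrec.fst.comp Primrec.fst) hi)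
      ((Primrec.list_getD false).comp (Primrec.snd.comp Primrec.fst) hi)).to₂

@[simp] theorem length_restrict (A : Seq2) (n : ℕ) : (restrict A n).length = n := by
  simp [restrict]

theorem getD_restrict {A : Seq2} {n i : ℕ} (h : i < n) : (restrict A n).getD i false = A i := by
  simp [restrict, List.getD_eq_getElem?_getD, h]

theorem joinStr_restrict (A B : Seq2) (n : ℕ) :
    joinStr (restrict A n) (restrict B n) = restrict (join A B) n := by
  rw [joinStr, length_restrict]
  change _ = (List.range n).map (join A B)
  refine List.map_congr_left fun i hi => ?_
  have hi' : i / 2 < n := (Nat.div_le_self _ _).trans_lt (List.mem_range.1 hi)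
  rw [getD_restrict hi', getD_restrict hi', join]
  by_cases h : i % 2 = 0 <;> simp [h]

/-- Programs for the join: a program `p` with output of length `n`, followed by the codes of two
strings of length `n`. -/
def joinCode (E : ℕ → Option (BinStr × BinStr)) (d D u : ℕ) : Option (BinStr × BinStr) :=
  (E u.unpair.1).bind fun r =>
    (indexCode E d D r u.unpair.2.unpair.1).bind fun a =>
      (indexCode E d D r u.unpair.2.unpair.2).map fun b =>
        (r.1 ++ (a.1 ++ b.1), joinStr a.2 b.2)

theorem computable_joinCode {E : ℕ → Option (BinStr × BinStr)} (hE : Computable E) (d D : ℕ) :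
    Computable (joinCode E d D) := by
  have h₁ : Computable fun u : ℕ => u.unpair.1 := (Primrec.fst.comp Primrec.unpair).to_comp
  have h₂ : Computable fun u : ℕ => u.unpair.2 := (Primrec.snd.comp Primrec.unpair).to_comp
  have h : Primrec fun z : (BinStr × BinStr) × (BinStr × BinStr) × (BinStr × BinStr) =>
      (z.1.1 ++ (z.2.1.1 ++ z.2.2.1), joinStr z.2.1.2 z.2.2.2) := by
    have ha : Primrec fun z : (BinStr × BinStr) × (BinStr × BinStr) × (BinStr × BinStr) => z.2.1 :=
      Primrec.fst.comp Primrec.snd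
    have hb : Primrec fun z : (BinStr × BinStr) × (BinStr × BinStr) × (BinStr × BinStr) => z.2.2 :=
      Primrec.snd.comp Primrec.snd
    exact Primrec.pair (Primrec.list_append.comp (Primrec.fst.comp Primrec.fst)
      (Primrec.list_append.comp (Primrec.fst.comp ha) (Primrec.fst.comp hb)))
      (primrec_joinStr.comp (Primrec.snd.comp ha) (Primrec.snd.comp hb))
  have hI := computable_indexCode hE d D
  have hb : Computable₂ fun (x : (ℕ × BinStr × BinStr)) (a : BinStr × BinStr) =>
      (indexCode E d D x.2 x.1.unpair.2.unpair.2).map fun b =>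
        (x.2.1 ++ (a.1 ++ b.1), joinStr a.2 b.2) :=
    Computable.option_map (hI.comp (Computable.snd.comp Computable.fst)
      (h₂.comp (h₂.comp (Computable.fst.comp Computable.fst))))
      (h.to_comp.comp (Computable.pair (Computable.snd.comp (Computable.fst.comp Computable.fst))
        (Computable.pair (Computable.snd.comp Computable.fst) Computable.snd))).to₂
  have ha : Computable₂ fun (u : ℕ) (r : BinStr × BinStr) =>
      (indexCode E d D r u.unpair.2.unpair.1).bind fun a =>
        (indexCode E d D r u.unpair.2.unpair.2).map fun b =>
          (r.1 ++ (a.1 ++ b.1), joinStr a.2 b.2) :=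
    Computable.option_bind (hI.comp Computable.snd (h₁.comp (h₂.comp Computable.fst))) hb
  exact Computable.option_bind (hE.comp h₁) ha

theorem isPrefixCode_joinCode {E : ℕ → Option (BinStr × BinStr)} (hE : IsPrefixCode E)
    (d D : ℕ) : IsPrefixCode (joinCode E d D) := by
  intro u v p y q z hu hv hpq
  simp only [joinCode, Option.bind_eq_some_iff, Option.map_eq_some_iff, Prod.mk.injEq] at hu hv
  obtain ⟨r, hr, a, ha, b, hb, rfl, rfl⟩ := hu
  obtain ⟨r', hr', a', ha', b', hb', rfl, rfl⟩ := hv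
  have hrr : r = r' := by
    rcases List.prefix_or_prefix_of_prefix ((List.prefix_append _ _).trans hpq)
      (List.prefix_append _ _) with h | h
    · exact Prod.ext_iff.2 (hE _ _ _ _ _ _ hr hr' h)
    · exact (Prod.ext_iff.2 (hE _ _ _ _ _ _ hr' hr h)).symm
  subst hrr
  rw [List.prefix_append_right_inj] at hpq
  have haa := indexCode_inj ha ha' (List.prefix_or_prefix_of_prefix
    ((List.prefix_append _ _).trans hpq) (List.prefix_append _ _))
  subst haa
  rw [List.prefix_append_right_inj] at hpq
  have hbb := indexCode_inj hb hb' (Or.inl hpq)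
  subst hbb
  exact ⟨rfl, rfl⟩

theorem exists_Kc_join_le (U : UniversalPrefixMachine) : ∃ c, ∀ (A B : Seq2) (n e f : ℕ),
    Kc U (restrict A n) ≤ KcNat U n + e → Kc U (restrict B n) ≤ KcNat U n + f →
      Kc U (restrict (join A B) n) ≤ KcNat U n + 3 * e + 3 * f + c := by
  obtain ⟨E, hE⟩ := exists_isGraphEnum U
  obtain ⟨D, hD⟩ := exists_occ_lt hE
  obtain ⟨d, hd⟩ := exists_Kc_comp_le U (f := fun y => y.map fun _ => false)
    (Primrec.list_map Primrec.id (Primrec₂.const false)).to_comp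
  obtain ⟨c, hc⟩ := (isPrefixCode_joinCode hE.isPrefixCode d D).exists_Kc_le U
    (computable_joinCode hE.computable d D)
  have hcode : ∀ (A : Seq2) (n e : ℕ) (p : BinStr), p.length = KcNat U n →
      Kc U (restrict A n) ≤ KcNat U n + e → ∃ s x,
        indexCode E d D (p, List.replicate n false) s = some x ∧ x.2 = restrict A n ∧
          x.1.length ≤ 3 * (e + d) + 2 * D + 1 := by
    intro A n e p hp he
    obtain ⟨s, q, hs, hq⟩ := hE.exists_eq (restrict A n)
    have h := hd (restrict A n)
    rw [List.map_const', length_restrict] at h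
    change KcNat U n ≤ _ at h
    obtain ⟨e', he'⟩ := Nat.exists_eq_add_of_le h
    refine ⟨s, (pairCode D e' (occ (sizeKey E) s), restrict A n), indexCode_eq_some_iff.2
      ⟨q, e', hs, by simp, by rw [hp, hq]; exact he', hD s q _ e' hs ?_, rfl⟩, rfl, ?_⟩
    · rw [length_restrict]
      omega
    · rw [length_pairCode]
      omega
  refine ⟨6 * d + 4 * D + 2 + c, fun A B n e f hA hB => ?_⟩
  obtain ⟨s, p, hs, hp⟩ := hE.exists_eq (List.replicate n false)
  change _ = KcNat U n at hp
  obtain ⟨s₁, a, ha, haA, hal⟩ := hcode A n e p hp hA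
  obtain ⟨s₂, b, hb, hbB, hbl⟩ := hcode B n f p hp hB
  have h := hc (Nat.pair s (Nat.pair s₁ s₂)) (p ++ (a.1 ++ b.1)) (joinStr a.2 b.2)
    (by simp [joinCode, hs, ha, hb])
  rw [haA, hbB, joinStr_restrict, List.length_append, List.length_append] at h
  omega

theorem Delta02Fun.comp_right {g u : ℕ → ℕ} (hg : Delta02Fun g) (hu : Computable u) :
    Delta02Fun fun n => g (u n) := by
  obtain ⟨G, hG, h⟩ := hg
  exact ⟨fun s x => G s (u x), hG.comp Computable.fst (hu.comp Computable.snd), fun x => h (u x)⟩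

theorem Delta02Fun.comp_left {g u : ℕ → ℕ} (hg : Delta02Fun g) (hu : Computable u) :
    Delta02Fun fun n => u (g n) := by
  obtain ⟨G, hG, h⟩ := hg
  refine ⟨fun s x => u (G s x), hu.comp hG, fun x => ?_⟩
  obtain ⟨t, ht⟩ := h x
  exact ⟨t, fun s hs => congrArg u (ht s hs)⟩

theorem computable_div_const (k : ℕ) : Computable fun n : ℕ => n / k :=
  (Primrec.nat_div.comp Primrec.id (Primrec.const k)).to_comp

theorem KTDelta.join {U : UniversalPrefixMachine} {A B : Seq2} (hA : KTDelta U A)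
    (hB : KTDelta U B) : KTDelta U (join A B) := by
  intro g hg hord
  have hg' : Delta02Fun fun n => g n / 6 := hg.comp_left (computable_div_const 6)
  have hord' : IsOrder fun n => g n / 6 := by
    refine ⟨fun m n h => Nat.div_le_div_right (hord.1 h), fun b => ?_⟩
    obtain ⟨m, hm⟩ := hord.2 (6 * b + 6)
    exact ⟨m, (Nat.le_div_iff_mul_le (by omega)).2 (by omega)⟩
  obtain ⟨cA, hcA⟩ := hA _ hg' hord'
  obtain ⟨cB, hcB⟩ := hB _ hg' hord'
  obtain ⟨c, hc⟩ := exists_Kc_join_le U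
  refine ⟨3 * cA + 3 * cB + c, fun n => ?_⟩
  have := hc A B n (g n / 6 + cA) (g n / 6 + cB) (by simpa only [add_assoc] using hcA n)
    (by simpa only [add_assoc] using hcB n)
  omega

/-- If the initial segments of `B` are computable from those of `A` of twice the length, then `B`
is as `K`-trivial as `A`. -/
theorem KTDelta.of_restrict_eq {U : UniversalPrefixMachine} {A B : Seq2} (hA : KTDelta U A)
    {f : BinStr → BinStr} (hf : Computable f) (h : ∀ n, f (restrict A (2 * n)) = restrict B n) :
    KTDelta U B := by
  intro g hg hord
  have hord' : IsOrder fun n => g (n / 2) := by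
    refine ⟨fun m n h => hord.1 (Nat.div_le_div_right h), fun b => ?_⟩
    obtain ⟨m, hm⟩ := hord.2 b
    exact ⟨2 * m, by simpa using hm⟩
  obtain ⟨cA, hcA⟩ := hA _ (hg.comp_right (computable_div_const 2)) hord'
  obtain ⟨cf, hcf⟩ := exists_Kc_comp_le U hf
  obtain ⟨cd, hcd⟩ := exists_Kc_comp_le U (f := fun y => y ++ y)
    (Computable.list_append.comp Computable.id Computable.id)
  refine ⟨cA + cf + cd, fun n => ?_⟩
  have h1 : _ ≤ _ + g (2 * n / 2) + cA := hcA (2 * n)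
  have h2 := hcf (restrict A (2 * n))
  have h3 := hcd (List.replicate n false)
  rw [h] at h2
  rw [List.replicate_append_replicate, ← two_mul] at h3
  change KcNat U (2 * n) ≤ KcNat U n + cd at h3
  rw [Nat.mul_div_cancel_left n two_pos] at h1
  omega

theorem KTDelta.of_join_mod {U : UniversalPrefixMachine} {A B C : Seq2}
    (h : KTDelta U (_root_.join A B)) {k : ℕ} (hk : k < 2)
    (hC : ∀ i, _root_.join A B (2 * i + k) = C i) : KTDelta U C := by
  have hf : Primrec fun y : BinStr => (List.range (y.length / 2)).map fun i =>
      y.getD (2 * i + k) false :=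
    Primrec.list_map (Primrec.list_range.comp (Primrec.nat_div.comp Primrec.list_length
      (Primrec.const 2))) ((Primrec.list_getD false).comp Primrec.fst (Primrec.nat_add.comp
        (Primrec.nat_mul.comp (Primrec.const 2) Primrec.snd) (Primrec.const k))).to₂
  refine h.of_restrict_eq hf.to_comp fun n => ?_
  rw [length_restrict, Nat.mul_div_cancel_left n two_pos]
  change _ = (List.range n).map C
  refine List.map_congr_left fun i hi => ?_
  rw [List.mem_range] at hi
  exact (getD_restrict (by omega)).trans (hC i)

/-- KT(Δ⁰₂) is closed under effective join: A, B ∈ KT(Δ⁰₂) iff A ⊕ B ∈ KT(Δ⁰₂). -/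
theorem stmt12 (U : UniversalPrefixMachine) (A B : Seq2) :
    (KTDelta U A ∧ KTDelta U B) ↔ KTDelta U (join A B) := by
  refine ⟨fun h => h.1.join h.2, fun h => ⟨h.of_join_mod (k := 0) two_pos fun i => ?_,
    h.of_join_mod (k := 1) one_lt_two fun i => ?_⟩⟩
  · simp [join]
  · rw [join, if_neg (by omega), show (2 * i + 1) / 2 = i by omega]
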